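/- arXiv:2005.14307 — 4 statements merged into one kernel-verified Lean document; each statement's English description precedes it below -/
import Mathlib

section
/- Let C ⊆ ℕ be an infinite computable set, let A ⊆ ℕ, and let r ∈ ℝ. If A has intrinsic density r, then A ◁ C (A within C) has intrinsic density r. -/
open Filter Set Topology

open scoped Classical

/-- The density of `A` at `n`: `|A ∩ {0,…,n−1}| / n`. -/
noncomputable def pdens (A : Set ℕ) (n : ℕ) : ℝ :=
  ((Finset.range n).filter (· ∈ A)).card / n

/-- The upper density of `A`. -/
noncomputable def upperDensity (A : Set ℕ) : ℝ :=
  Filter.limsup (pdens A) Filter.atTop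

/-- The lower density of `A`. -/
noncomputable def lowerDensity (A : Set ℕ) : ℝ :=
  Filter.liminf (pdens A) Filter.atTop

/-- `A` has (asymptotic) density `r`. -/
def HasDensity (A : Set ℕ) (r : ℝ) : Prop :=
  Filter.Tendsto (pdens A) Filter.atTop (nhds r)

/-- The `n`-th element of `A` in increasing order. -/
noncomputable def nthElem (A : Set ℕ) (n : ℕ) : ℕ :=
  Nat.nth (· ∈ A) n

/-- A computable permutation of `ℕ`. -/
def IsComputablePerm (π : ℕ → ℕ) : Prop :=
  Function.Bijective π ∧ Computable π

/-- `A` has intrinsic density `r`: the density of `π(A)` exists and equals `r`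
for every computable permutation `π`. -/
def HasIntrinsicDensity (A : Set ℕ) (r : ℝ) : Prop :=
  ∀ π : ℕ → ℕ, IsComputablePerm π → HasDensity (π '' A) r

/-- The join `A ⊕ B = {2n : n ∈ A} ∪ {2n+1 : n ∈ B}`. -/
def join (A B : Set ℕ) : Set ℕ :=
  (fun n => 2 * n) '' A ∪ (fun n => 2 * n + 1) '' B

/-- `B ▷ A`, "`B` into `A`": the set of `B`-th elements of `A`. -/
noncomputable def into (B A : Set ℕ) : Set ℕ :=
  nthElem A '' B

/-- `B ◁ A`, "`B` within `A`": `{n : a_n ∈ B}`. -/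
noncomputable def within (B A : Set ℕ) : Set ℕ :=
  {n | nthElem A n ∈ B}

theorem ComputablePred.computable_count {p : ℕ → Prop} [inst : DecidablePred p]
    (hp : ComputablePred p) : Computable fun n => Nat.count p n := by
  obtain ⟨inst', h⟩ := hp
  obtain rfl : inst' = inst := Subsingleton.elim _ _
  have hstep : Computable₂ fun (_ : ℕ) (y : ℕ × ℕ) => bif decide (p y.1) then y.2 + 1 else y.2 :=
    (Computable.cond (h.comp (Computable.fst.comp Computable.snd))
      (Computable.succ.comp (Computable.snd.comp Computable.snd))
      (Computable.snd.comp Computable.snd)).to₂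
  refine (Computable.nat_rec Computable.id (Computable.const 0) hstep).of_eq fun n => ?_
  simp only [id]
  induction n with
  | zero => simp
  | succ k ih =>
    rw [Nat.count_succ]
    simp only [ih]
    by_cases hk : p k <;> simp [hk]

theorem ComputablePred.computable_nth {p : ℕ → Prop} (hp : ComputablePred p)
    (hinf : (Set.ofPred p).Infinite) : Computable (Nat.nth p) := by
  obtain ⟨inst, h⟩ := id hp
  have hcount := hp.computable_count
  have hq : Computable₂ fun n x : ℕ => decide (p x) && decide (Nat.count p x = n) :=
    (Primrec.and.to_comp.comp (h.comp Computable.snd)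
      (Primrec.eq (α := ℕ).decide.to_comp.comp (hcount.comp Computable.snd) Computable.fst)).to₂
  refine (Partrec.rfind hq.partrec₂).of_eq_tot fun n => ?_
  refine Nat.mem_rfind.2 ⟨?_, fun {m} hm => ?_⟩
  · simp [Nat.nth_mem_of_infinite hinf n, Nat.count_nth_of_infinite hinf n]
  · suffices ¬ (p m ∧ Nat.count p m = n) by simpa using this
    rintro ⟨hpm, rfl⟩
    rw [Nat.nth_count hpm] at hm
    exact lt_irrefl _ hm

/-- `k` is not the square of an element of the complement of `C`. -/
def NonReserved (C : Set ℕ) (k : ℕ) : Prop :=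
  ¬ (k.sqrt * k.sqrt = k ∧ k.sqrt ∉ C)

theorem computablePred_nonReserved {C : Set ℕ} (hC : ComputablePred (· ∈ C)) :
    ComputablePred (NonReserved C) := by
  obtain ⟨inst, h⟩ := hC
  refine ⟨inferInstance, ?_⟩
  have hs : Computable Nat.sqrt := Primrec.nat_sqrt.to_comp
  have h1 : Computable fun k : ℕ => decide (k.sqrt * k.sqrt = k) :=
    Primrec.eq (α := ℕ).decide.to_comp.comp
      (Primrec.nat_mul.to_comp.comp hs hs) Computable.id
  refine (Primrec.not.to_comp.comp (Primrec.and.to_comp.comp h1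
    (Primrec.not.to_comp.comp (h.comp hs)))).of_eq fun k => ?_
  by_cases h1 : k.sqrt * k.sqrt = k <;> by_cases h2 : k.sqrt ∈ C <;> simp [NonReserved, h1, h2]

theorem not_nonReserved_iff {C : Set ℕ} {k : ℕ} :
    ¬ NonReserved C k ↔ ∃ x ∉ C, x * x = k := by
  unfold NonReserved
  rw [not_not]
  constructor
  · rintro ⟨h1, h2⟩
    exact ⟨_, h2, h1⟩
  · rintro ⟨x, hx, rfl⟩
    simp [Nat.sqrt_eq, hx]

theorem infinite_nonReserved (C : Set ℕ) : (Set.ofPred (NonReserved C)).Infinite := by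
  refine Set.infinite_of_injective_forall_mem (f := fun n : ℕ => (n + 1) * (n + 1) + 1) ?_ ?_
  · intro a b hab
    have : (a + 1) * (a + 1) = (b + 1) * (b + 1) := by simpa using hab
    have := Nat.mul_self_inj.1 this
    omega
  · intro n
    by_contra hn
    obtain ⟨x, -, hx⟩ := not_nonReserved_iff.1 hn
    rcases le_or_gt x (n + 1) with h | h
    · nlinarith
    · nlinarith

/-- The permutation sending the `i`-th element of `C` to the `π i`-th non-reserved position, and
each element outside `C` to its square. -/
noncomputable def liftPerm (C : Set ℕ) (π : ℕ → ℕ) (x : ℕ) : ℕ :=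
  if x ∈ C then Nat.nth (NonReserved C) (π (Nat.count (· ∈ C) x)) else x * x

theorem liftPerm_of_not_mem {C : Set ℕ} (π : ℕ → ℕ) {x : ℕ} (hx : x ∉ C) :
    liftPerm C π x = x * x := if_neg hx

theorem liftPerm_of_mem {C : Set ℕ} (π : ℕ → ℕ) {x : ℕ} (hx : x ∈ C) :
    liftPerm C π x = Nat.nth (NonReserved C) (π (Nat.count (· ∈ C) x)) := if_pos hx

theorem nonReserved_liftPerm_iff {C : Set ℕ} (π : ℕ → ℕ) {x : ℕ} :
    NonReserved C (liftPerm C π x) ↔ x ∈ C := by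
  by_cases hx : x ∈ C
  · rw [liftPerm_of_mem π hx]
    exact iff_of_true (Nat.nth_mem_of_infinite (infinite_nonReserved C) _) hx
  · rw [liftPerm_of_not_mem π hx]
    exact iff_of_false (not_nonReserved_iff.2 ⟨x, hx, rfl⟩) hx

theorem liftPerm_nth {C : Set ℕ} (hC : C.Infinite) (π : ℕ → ℕ) (i : ℕ) :
    liftPerm C π (Nat.nth (· ∈ C) i) = Nat.nth (NonReserved C) (π i) := by
  have hi : Nat.nth (· ∈ C) i ∈ C := Nat.nth_mem_of_infinite (p := (· ∈ C)) hC i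
  rw [liftPerm_of_mem π hi, Nat.count_nth_of_infinite (p := (· ∈ C)) hC]

theorem isComputablePerm_liftPerm {C : Set ℕ} (hCinf : C.Infinite)
    (hCcomp : ComputablePred (· ∈ C)) {π : ℕ → ℕ} (hπ : IsComputablePerm π) :
    IsComputablePerm (liftPerm C π) := by
  obtain ⟨⟨hinj, hsurj⟩, hcomp⟩ := hπ
  refine ⟨⟨fun x y hxy => ?_, fun k => ?_⟩, ?_⟩
  · have hiff : x ∈ C ↔ y ∈ C := by
      rw [← nonReserved_liftPerm_iff π, hxy, nonReserved_liftPerm_iff π]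
    by_cases hx : x ∈ C
    · have hy := hiff.1 hx
      rw [liftPerm_of_mem π hx, liftPerm_of_mem π hy] at hxy
      exact Nat.count_injective hx hy
        (hinj (Nat.nth_injective (infinite_nonReserved C) hxy))
    · rw [liftPerm_of_not_mem π hx, liftPerm_of_not_mem π (fun hy => hx (hiff.2 hy))] at hxy
      exact Nat.mul_self_inj.1 hxy
  · by_cases hk : NonReserved C k
    · obtain ⟨i, hi⟩ := hsurj (Nat.count (NonReserved C) k)
      exact ⟨Nat.nth (· ∈ C) i, by rw [liftPerm_nth hCinf, hi, Nat.nth_count hk]⟩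
    · obtain ⟨x, hx, rfl⟩ := not_nonReserved_iff.1 hk
      exact ⟨x, liftPerm_of_not_mem π hx⟩
  · have hnth := (computablePred_nonReserved hCcomp).computable_nth (infinite_nonReserved C)
    have hcount := hCcomp.computable_count
    obtain ⟨inst, h⟩ := hCcomp
    refine (Computable.cond h (hnth.comp (hcomp.comp hcount))
      (Primrec.nat_mul.to_comp.comp Computable.id Computable.id)).of_eq fun x => ?_
    by_cases hx : x ∈ C
    · simp [liftPerm_of_mem π hx, hx]
    · simp [liftPerm_of_not_mem π hx, hx]

theorem nth_mem_image_liftPerm_iff {C : Set ℕ} (hC : C.Infinite) {π : ℕ → ℕ} (A : Set ℕ)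
    (j : ℕ) : Nat.nth (NonReserved C) j ∈ liftPerm C π '' A ↔ j ∈ π '' within A C := by
  constructor
  · rintro ⟨x, hxA, hx⟩
    have hxC : x ∈ C := by
      rw [← nonReserved_liftPerm_iff π, hx]
      exact Nat.nth_mem_of_infinite (infinite_nonReserved C) j
    rw [liftPerm_of_mem π hxC] at hx
    refine ⟨Nat.count (· ∈ C) x, ?_, Nat.nth_injective (infinite_nonReserved C) hx⟩
    change Nat.nth (· ∈ C) (Nat.count (· ∈ C) x) ∈ A
    rwa [Nat.nth_count (p := (· ∈ C)) hxC]
  · rintro ⟨i, hi, rfl⟩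
    exact ⟨Nat.nth (· ∈ C) i, hi, liftPerm_nth hC π i⟩

theorem card_filter_range_nth_le (C D E : Set ℕ)
    (h : ∀ j, Nat.nth (NonReserved C) j ∈ D ↔ j ∈ E) (n : ℕ) :
    ((Finset.range (Nat.nth (NonReserved C) n)).filter (· ∈ D)).card ≤
      ((Finset.range n).filter (· ∈ E)).card + ((Nat.nth (NonReserved C) n).sqrt + 1) := by
  set t := Nat.nth (NonReserved C) n with ht
  have hsub : (Finset.range t).filter (· ∈ D) ⊆
      ((Finset.range n).filter (· ∈ E)).image (Nat.nth (NonReserved C)) ∪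
        (Finset.range (t.sqrt + 1)).image (fun x => x * x) := by
    intro k hk
    obtain ⟨hkt, hkD⟩ := Finset.mem_filter.1 hk
    rw [Finset.mem_range] at hkt
    rw [Finset.mem_union, Finset.mem_image, Finset.mem_image]
    by_cases hR : NonReserved C k
    · refine Or.inl ⟨Nat.count (NonReserved C) k, ?_, Nat.nth_count hR⟩
      rw [← Nat.nth_count hR] at hkt hkD
      rw [Finset.mem_filter, Finset.mem_range]
      exact ⟨(Nat.nth_lt_nth (infinite_nonReserved C)).1 hkt, (h _).1 hkD⟩
    · obtain ⟨x, -, rfl⟩ := not_nonReserved_iff.1 hR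
      exact Or.inr ⟨x, Finset.mem_range.2 (Nat.lt_succ_of_le (Nat.le_sqrt.2 hkt.le)), rfl⟩
  refine (Finset.card_le_card hsub).trans ((Finset.card_union_le _ _).trans ?_)
  refine Nat.add_le_add Finset.card_image_le (Finset.card_image_le.trans ?_)
  simp

theorem card_filter_range_le_nth (C D E : Set ℕ)
    (h : ∀ j, Nat.nth (NonReserved C) j ∈ D ↔ j ∈ E) (n : ℕ) :
    ((Finset.range n).filter (· ∈ E)).card ≤
      ((Finset.range (Nat.nth (NonReserved C) n)).filter (· ∈ D)).card := by
  refine Finset.card_le_card_of_injOn (Nat.nth (NonReserved C)) ?_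
    (Nat.nth_injective (infinite_nonReserved C)).injOn
  intro j hj
  obtain ⟨hjn, hjE⟩ := Finset.mem_filter.1 hj
  refine Finset.mem_coe.2 (Finset.mem_filter.2 ⟨?_, (h j).2 hjE⟩)
  exact Finset.mem_range.2
    ((Nat.nth_lt_nth (infinite_nonReserved C)).2 (Finset.mem_range.1 hjn))

theorem tendsto_natSqrt_add_one_div_atTop :
    Tendsto (fun n : ℕ => ((n.sqrt + 1 : ℕ) : ℝ) / n) atTop (𝓝 0) := by
  have hup : Tendsto (fun n : ℕ => (√(n : ℝ))⁻¹ + (n : ℝ)⁻¹) atTop (𝓝 0) := by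
    simpa using (tendsto_inv_atTop_zero.comp
      (Real.tendsto_sqrt_atTop.comp tendsto_natCast_atTop_atTop)).add
      (tendsto_inv_atTop_nhds_zero_nat (𝕜 := ℝ))
  refine squeeze_zero (fun n => by positivity) (fun n => ?_) hup
  rw [← Real.sqrt_div_self, ← one_div (n : ℝ), ← add_div]
  push_cast
  gcongr
  exact Real.nat_sqrt_le_real_sqrt

/-- If the non-reserved part of `D` is the set of `E`-th non-reserved positions, then `E` inherits
the density of `D`. -/
theorem HasDensity.of_nth_nonReserved {C D E : Set ℕ} {r : ℝ} (hD : HasDensity D r)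
    (h : ∀ j, Nat.nth (NonReserved C) j ∈ D ↔ j ∈ E) : HasDensity E r := by
  set t := Nat.nth (NonReserved C) with ht
  have htop : Tendsto t atTop atTop := (Nat.nth_strictMono (infinite_nonReserved C)).tendsto_atTop
  have key : ∀ {D E : Set ℕ} {r : ℝ}, HasDensity D r → (∀ j, t j ∈ D ↔ j ∈ E) →
      Tendsto (fun n => (((Finset.range n).filter (· ∈ E)).card : ℝ) / t n) atTop (𝓝 r) := by
    intro D E r hD h
    have hDt : Tendsto (fun n => pdens D (t n)) atTop (𝓝 r) := hD.comp htop
    have herr := tendsto_natSqrt_add_one_div_atTop.comp htop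
    refine tendsto_of_tendsto_of_tendsto_of_le_of_le (by simpa using hDt.sub herr) hDt
      (fun n => ?_) (fun n => ?_)
    · have := card_filter_range_nth_le C D E h n
      simp only [pdens, ← sub_div]
      gcongr
      rw [sub_le_iff_le_add]
      exact_mod_cast this
    · have := card_filter_range_le_nth C D E h n
      simp only [pdens]
      gcongr
  have huniv : HasDensity Set.univ 1 := by
    refine tendsto_const_nhds.congr' ?_
    filter_upwards [eventually_gt_atTop 0] with n hn
    have : (n : ℝ) ≠ 0 := by positivity
    simp [pdens, this]
  have h1 := key (E := Set.univ) huniv (by simp)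
  have hdiv := (key hD h).div h1 one_ne_zero
  rw [div_one] at hdiv
  refine hdiv.congr' ?_
  filter_upwards [htop.eventually_gt_atTop 0] with n hn
  have : (t n : ℝ) ≠ 0 := by positivity
  simp only [pdens, Pi.div_apply]
  rw [div_div_div_cancel_right₀ this]
  simp

theorem stmt9 (C : Set ℕ) (hCinf : C.Infinite) (hCcomp : ComputablePred (· ∈ C))
    (A : Set ℕ) (r : ℝ) (hA : HasIntrinsicDensity A r) :
    HasIntrinsicDensity (within A C) r := fun _ hπ =>
  (hA _ (isComputablePerm_liftPerm hCinf hCcomp hπ)).of_nth_nonReserved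
    (nth_mem_image_liftPerm_iff hCinf A)
end

section
/- Let A, B ⊆ ℕ be infinite. Then the lower density of B ▷ A is at least the product of the lower density of B and the lower density of A: ρ_(B ▷ A) ≥ ρ_(B)·ρ_(A). -/
open Filter Set Topology

open scoped Classical

theorem pdens_nonneg (A : Set ℕ) (n : ℕ) : 0 ≤ pdens A n := by
  unfold pdens
  positivity

theorem pdens_le_one (A : Set ℕ) (n : ℕ) : pdens A n ≤ 1 := by
  refine div_le_one_of_le₀ ?_ n.cast_nonneg
  exact_mod_cast (Finset.card_filter_le _ _).trans_eq (Finset.card_range n)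

theorem card_filter_into {A : Set ℕ} (hA : A.Infinite) (B : Set ℕ) (n : ℕ) :
    ((Finset.range n).filter (· ∈ into B A)).card =
      ((Finset.range (Nat.count (· ∈ A) n)).filter (· ∈ B)).card := by
  have hmono : StrictMono (nthElem A) := Nat.nth_strictMono hA
  have himage : (Finset.range n).filter (· ∈ into B A) =
      ((Finset.range (Nat.count (· ∈ A) n)).filter (· ∈ B)).image (nthElem A) := by
    ext x
    simp only [Finset.mem_filter, Finset.mem_range, Finset.mem_image, into, Set.mem_image]
    constructor
    · rintro ⟨hx, b, hb, rfl⟩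
      exact ⟨b, ⟨(Nat.count_nth_of_infinite (p := (· ∈ A)) hA b).symm.trans_lt
        (Nat.count_strict_mono (p := (· ∈ A)) (Nat.nth_mem_of_infinite hA b) hx), hb⟩, rfl⟩
    · rintro ⟨b, ⟨hlt, hb⟩, rfl⟩
      exact ⟨Nat.nth_lt_of_lt_count hlt, b, hb, rfl⟩
  rw [himage, Finset.card_image_of_injective _ hmono.injective]

theorem pdens_into {A : Set ℕ} (hA : A.Infinite) (B : Set ℕ) (n : ℕ) :
    pdens (into B A) n = pdens B (Nat.count (· ∈ A) n) * pdens A n := by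
  unfold pdens
  rw [card_filter_into hA, ← Nat.count_eq_card_filter_range (· ∈ A) n]
  rcases Nat.eq_zero_or_pos (Nat.count (· ∈ A) n) with h | h
  · simp [h]
  · field_simp

theorem tendsto_count_atTop {A : Set ℕ} (hA : A.Infinite) :
    Tendsto (Nat.count (· ∈ A)) atTop atTop :=
  tendsto_atTop_atTop_of_monotone (Nat.count_monotone _)
    fun b => ⟨Nat.nth (· ∈ A) b, (Nat.count_nth_of_infinite (p := (· ∈ A)) hA b).ge⟩

theorem stmt11 (A B : Set ℕ) (hA : A.Infinite) (hB : B.Infinite) :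
    lowerDensity (into B A) ≥ lowerDensity B * lowerDensity A := by
  have hbelow : IsBoundedUnder (· ≥ ·) atTop (pdens B) :=
    isBoundedUnder_of ⟨0, pdens_nonneg B⟩
  have hcount : IsBoundedUnder (· ≤ ·) atTop (pdens B ∘ Nat.count (· ∈ A)) :=
    isBoundedUnder_of ⟨1, fun _ => pdens_le_one B _⟩
  have hle : IsBoundedUnder (· ≤ ·) atTop (pdens A) :=
    isBoundedUnder_of ⟨1, pdens_le_one A⟩
  have hA0 : 0 ≤ lowerDensity A :=
    le_liminf_of_le hle.isCoboundedUnder_ge (Eventually.of_forall (pdens_nonneg A))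
  calc lowerDensity B * lowerDensity A
      ≤ liminf (pdens B ∘ Nat.count (· ∈ A)) atTop * lowerDensity A :=
        mul_le_mul_of_nonneg_right
          ((tendsto_count_atTop hA).liminf_le_liminf_comp
            hcount.isCoboundedUnder_ge hbelow) hA0
    _ ≤ liminf ((pdens B ∘ Nat.count (· ∈ A)) * pdens A) atTop :=
        le_liminf_mul (Eventually.of_forall fun _ => pdens_nonneg B _) hcount
          (Eventually.of_forall (pdens_nonneg A)) hle.isCoboundedUnder_ge
    _ = lowerDensity (into B A) :=
        congrArg (liminf · atTop) (funext fun n => (pdens_into hA B n).symm)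
end

section
/- Let A ⊆ ℕ have intrinsic density 1/2 and let Ā denote its complement. Then A ⊕ Ā has intrinsic density 1/2, the identity A ▷ (A ⊕ Ā) = A ⊕ ∅ holds, and A ▷ (A ⊕ Ā) does not have intrinsic density (there is no r ∈ ℝ such that ρ(π(A ▷ (A ⊕ Ā))) exists and equals r for every computable permutation π). -/
open Filter Set Topology

open scoped Classical

theorem pdens_eq_count (A : Set ℕ) (n : ℕ) : pdens A n = (Nat.count (· ∈ A) n : ℝ) / n := by
  rw [pdens, Nat.count_eq_card_filter_range]

theorem pdens_union {A B : Set ℕ} (h : Disjoint A B) (n : ℕ) :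
    pdens (A ∪ B) n = pdens A n + pdens B n := by
  have hdisj : Disjoint ((Finset.range n).filter (· ∈ A)) ((Finset.range n).filter (· ∈ B)) :=
    Finset.disjoint_filter.2 fun x _ hA hB => Set.disjoint_left.1 h hA hB
  simp only [pdens, Set.mem_union, Finset.filter_or]
  rw [Finset.card_union_of_disjoint hdisj, Nat.cast_add, add_div]

theorem pdens_univ {n : ℕ} (hn : n ≠ 0) : pdens univ n = 1 := by
  simp [pdens, hn]

theorem HasIntrinsicDensity.compl {A : Set ℕ} {r : ℝ} (hA : HasIntrinsicDensity A r) :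
    HasIntrinsicDensity Aᶜ (1 - r) := by
  intro π hπ
  refine ((hA π hπ).const_sub 1).congr' ?_
  filter_upwards [eventually_ne_atTop 0] with n hn
  rw [image_compl_eq hπ.1, ← pdens_univ hn, ← union_compl_self (π '' A),
    pdens_union disjoint_compl_right]
  ring

theorem computable_natCount {p : ℕ → Prop} [DecidablePred p] (hp : ComputablePred p) :
    Computable (Nat.count p) := by
  have hstep : Computable₂ fun (_ : ℕ) (q : ℕ × ℕ) => bif decide (p q.1) then q.2 + 1 else q.2 :=
    (Computable.cond (hp.decide.comp (Computable.fst.comp Computable.snd))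
      (Computable.succ.comp (Computable.snd.comp Computable.snd))
      (Computable.snd.comp Computable.snd)).to₂
  refine (Computable.nat_rec Computable.id (Computable.const 0) hstep).of_eq fun n => ?_
  induction n with
  | zero => simp
  | succ n ih =>
    simp only [id] at ih ⊢
    rw [Nat.count_succ, ih]
    by_cases h : p n <;> simp [h]

/-- The inverse of a computable permutation is computable. -/
theorem IsComputablePerm.exists_inverse {π : ℕ → ℕ} (hπ : IsComputablePerm π) :
    ∃ g : ℕ → ℕ, Computable g ∧ Function.LeftInverse g π ∧ Function.RightInverse g π := by
  have hex : ∀ m, ∃ k, π k = m := hπ.1.2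
  have hspec : Function.RightInverse (fun m => Nat.find (hex m)) π := fun m => Nat.find_spec (hex m)
  refine ⟨fun m => Nat.find (hex m), ?_, hspec.leftInverse_of_injective hπ.1.1, hspec⟩
  have hdec : Computable₂ fun m k : ℕ => decide (π k = m) :=
    Primrec.eq.decide.to_comp.comp (hπ.2.comp Computable.snd) Computable.fst
  refine (Partrec.rfind hdec.partrec₂).of_eq_tot fun m => ?_
  rw [Nat.mem_rfind]
  refine ⟨?_, fun {j} hj => ?_⟩
  · simpa using Nat.find_spec (hex m)
  · simpa using Nat.find_min (hex m) hj

/-- Composing a computable injection with the ranking of its range gives a permutation. -/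
theorem isComputablePerm_count_range {f : ℕ → ℕ} (hf : Computable f) (hinj : f.Injective)
    (hR : ComputablePred (· ∈ range f)) :
    IsComputablePerm fun k => Nat.count (· ∈ range f) (f k) := by
  refine ⟨⟨fun a b h => hinj (Nat.count_injective (mem_range_self a) (mem_range_self b) h),
    fun m => ?_⟩, (computable_natCount hR).comp hf⟩
  have hinf : (range f).Infinite := infinite_range_of_injective hinj
  obtain ⟨k, hk⟩ := Nat.nth_mem_of_infinite (p := (· ∈ range f)) hinf m
  exact ⟨k, by simpa only [hk] using Nat.count_nth_of_infinite (p := (· ∈ range f)) hinf m⟩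

theorem count_image_count_range (f : ℕ → ℕ) (A : Set ℕ) (n : ℕ) :
    Nat.count (· ∈ (fun k => Nat.count (· ∈ range f) (f k)) '' A) (Nat.count (· ∈ range f) n) =
      Nat.count (· ∈ f '' A) n := by
  simp only [Nat.count_eq_card_filter_range (fun x => x ∈ f '' A),
    Nat.count_eq_card_filter_range (fun x => x ∈ (fun k => Nat.count (· ∈ range f) (f k)) '' A)]
  symm
  refine Finset.card_bij (fun m _ => Nat.count (· ∈ range f) m) ?_ ?_ ?_
  · intro m hm
    simp only [Finset.mem_filter, Finset.mem_range] at hm ⊢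
    obtain ⟨hmn, k, hk, rfl⟩ := hm
    exact ⟨Nat.count_strict_mono (p := (· ∈ range f)) (mem_range_self k) hmn, k, hk, rfl⟩
  · intro a ha b hb h
    simp only [Finset.mem_filter] at ha hb
    exact Nat.count_injective (p := (· ∈ range f)) (image_subset_range f A ha.2)
      (image_subset_range f A hb.2) h
  · intro b hb
    simp only [Finset.mem_filter, Finset.mem_range] at hb ⊢
    obtain ⟨hbn, k, hk, rfl⟩ := hb
    exact ⟨f k, ⟨Nat.lt_of_count_lt_count (p := (· ∈ range f)) hbn, k, hk, rfl⟩, rfl⟩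

theorem pdens_image_eq_mul (f : ℕ → ℕ) (A : Set ℕ) (n : ℕ) :
    pdens (f '' A) n =
      pdens ((fun k => Nat.count (· ∈ range f) (f k)) '' A) (Nat.count (· ∈ range f) n) *
        pdens (range f) n := by
  rw [pdens_eq_count, pdens_eq_count, pdens_eq_count, count_image_count_range f]
  rcases Nat.eq_zero_or_pos (Nat.count (· ∈ range f) n) with h | h
  · have := count_image_count_range f A n
    rw [h, Nat.count_zero] at this
    rw [h, ← this]
    simp only [Nat.cast_zero, zero_div, mul_zero]
  · field_simp

/-- Inside a computable set, a set of intrinsic density `r` occupies the fraction `r`. -/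
theorem HasIntrinsicDensity.tendsto_image_sub {A : Set ℕ} {r : ℝ} (hA : HasIntrinsicDensity A r)
    {f : ℕ → ℕ} (hf : Computable f) (hinj : f.Injective) (hR : ComputablePred (· ∈ range f)) :
    Tendsto (fun n => pdens (f '' A) n - r * pdens (range f) n) atTop (𝓝 0) := by
  have hcount : Tendsto (Nat.count (· ∈ range f)) atTop atTop :=
    tendsto_atTop_atTop.2 fun b => by
      have hinf : (range f).Infinite := infinite_range_of_injective hinj
      refine ⟨Nat.nth (· ∈ range f) b, fun n hn => ?_⟩
      have := Nat.count_monotone (· ∈ range f) hn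
      rwa [Nat.count_nth_of_infinite (p := (· ∈ range f)) hinf] at this
  have h := (((hA _ (isComputablePerm_count_range hf hinj hR)).comp hcount).sub_const r)
  rw [sub_self] at h
  refine (h.zero_mul_isBoundedUnder_le (g := pdens (range f)) ?_).congr fun n => ?_
  · refine isBoundedUnder_of ⟨1, fun n => ?_⟩
    simpa [abs_of_nonneg (pdens_nonneg _ n)] using pdens_le_one (range f) n
  · rw [pdens_image_eq_mul f A n]
    simp only [Function.comp]
    ring

theorem computablePred_range_two_mul_add {π g : ℕ → ℕ} (hg : Computable g)
    (hl : Function.LeftInverse g π) (hr : Function.RightInverse g π) {c : ℕ} (hc : c < 2) :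
    ComputablePred (· ∈ range fun k => π (2 * k + c)) := by
  have hmem : ∀ m, (m ∈ range fun k => π (2 * k + c)) ↔ g m % 2 = c := by
    refine fun m => ⟨?_, fun h => ⟨g m / 2, ?_⟩⟩
    · rintro ⟨k, rfl⟩
      simp only [hl _]
      lia
    · have : 2 * (g m / 2) + c = g m := by lia
      simp only [this, hr m]
  have hcomp : ComputablePred fun m => g m % 2 = c :=
    ⟨inferInstance, Primrec.eq.decide.to_comp.comp
      (Primrec.nat_mod.to_comp.comp hg (Computable.const 2)) (Computable.const c)⟩
  exact hcomp.of_eq fun m => (hmem m).symm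

theorem image_join (π : ℕ → ℕ) (A B : Set ℕ) :
    π '' join A B = (fun k => π (2 * k + 0)) '' A ∪ (fun k => π (2 * k + 1)) '' B := by
  simp only [_root_.join, image_union, image_image, add_zero]

/-- The join of two sets of intrinsic density `r` has intrinsic density `r`. -/
theorem HasIntrinsicDensity.join {A B : Set ℕ} {r : ℝ} (hA : HasIntrinsicDensity A r)
    (hB : HasIntrinsicDensity B r) : HasIntrinsicDensity (join A B) r := by
  intro π hπ
  obtain ⟨g, hg, hl, hr⟩ := hπ.exists_inverse
  have hcomp : ∀ c, Computable fun k => π (2 * k + c) := fun c =>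
    hπ.2.comp (Primrec.nat_add.comp
      (Primrec.nat_mul.comp (Primrec.const 2) Primrec.id) (Primrec.const c)).to_comp
  have hinj : ∀ c, Function.Injective fun k => π (2 * k + c) := fun c a b h => by
    have := hπ.1.1 h
    lia
  have hdisj : Disjoint (range fun k => π (2 * k + 0)) (range fun k => π (2 * k + 1)) := by
    rw [Set.disjoint_left]
    rintro _ ⟨a, rfl⟩ ⟨b, h⟩
    have := hπ.1.1 h
    lia
  have hcover : (range fun k => π (2 * k + 0)) ∪ (range fun k => π (2 * k + 1)) = univ := by
    refine eq_univ_of_forall fun m => ?_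
    rcases Nat.even_or_odd' (g m) with ⟨k, hk | hk⟩
    · exact Or.inl ⟨k, by simp only [add_zero, ← hk, hr m]⟩
    · exact Or.inr ⟨k, by simp only [← hk, hr m]⟩
  have h := ((hA.tendsto_image_sub (hcomp 0) (hinj 0)
    (computablePred_range_two_mul_add hg hl hr (by lia))).add
      (hB.tendsto_image_sub (hcomp 1) (hinj 1)
        (computablePred_range_two_mul_add hg hl hr (by lia)))).add_const r
  rw [add_zero, zero_add] at h
  refine h.congr' ?_
  filter_upwards [eventually_ne_atTop 0] with n hn
  rw [image_join, pdens_union (hdisj.mono (image_subset_range _ _) (image_subset_range _ _))]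
  have hone := pdens_univ hn
  rw [← hcover, pdens_union hdisj] at hone
  linear_combination (-r) * hone

theorem two_mul_mem_join {A B : Set ℕ} {n : ℕ} : 2 * n ∈ join A B ↔ n ∈ A := by
  simp only [_root_.join, mem_union, mem_image]
  grind

theorem two_mul_add_one_mem_join {A B : Set ℕ} {n : ℕ} : 2 * n + 1 ∈ join A B ↔ n ∈ B := by
  simp only [_root_.join, mem_union, mem_image]
  grind

theorem count_join_compl (A : Set ℕ) (n : ℕ) : Nat.count (· ∈ join A Aᶜ) (2 * n) = n := by
  induction n with
  | zero => simp
  | succ n ih =>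
    rw [show 2 * (n + 1) = 2 * n + 1 + 1 by ring, Nat.count_succ, Nat.count_succ, ih]
    simp only [two_mul_mem_join, two_mul_add_one_mem_join, mem_compl_iff]
    by_cases h : n ∈ A <;> simp [h]

theorem nthElem_join_compl {A : Set ℕ} {n : ℕ} (hn : n ∈ A) : nthElem (join A Aᶜ) n = 2 * n := by
  have := Nat.nth_count (p := (· ∈ join A Aᶜ)) (two_mul_mem_join.2 hn)
  rwa [count_join_compl] at this

theorem join_empty (A : Set ℕ) : join A ∅ = (2 * ·) '' A := by
  rw [_root_.join, image_empty, union_empty]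

theorem into_join_compl (A : Set ℕ) : into A (join A Aᶜ) = join A ∅ := by
  rw [into, join_empty]
  exact image_congr fun n hn => nthElem_join_compl hn

theorem count_image_mul (A : Set ℕ) {d : ℕ} (hd : d ≠ 0) (n : ℕ) :
    Nat.count (· ∈ (d * ·) '' A) (d * n) = Nat.count (· ∈ A) n := by
  simp only [Nat.count_eq_card_filter_range]
  symm
  refine Finset.card_bij (fun m _ => d * m) ?_ ?_ ?_
  · intro m hm
    simp only [Finset.mem_filter, Finset.mem_range] at hm ⊢
    exact ⟨Nat.mul_lt_mul_of_pos_left hm.1 (Nat.pos_of_ne_zero hd), mem_image_of_mem _ hm.2⟩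
  · intro a _ b _ h
    exact Nat.eq_of_mul_eq_mul_left (Nat.pos_of_ne_zero hd) h
  · intro b hb
    simp only [Finset.mem_filter, Finset.mem_range] at hb ⊢
    obtain ⟨hbn, k, hk, rfl⟩ := hb
    exact ⟨k, ⟨Nat.lt_of_mul_lt_mul_left hbn, hk⟩, rfl⟩

/-- Multiplication by `d` divides the density of a set by `d`. -/
theorem HasDensity.eq_div_of_image_mul {A : Set ℕ} {r s : ℝ} {d : ℕ} (hd : d ≠ 0)
    (hA : HasDensity A r) (h : HasDensity ((d * ·) '' A) s) : s = r / d := by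
  have hmul : Tendsto (fun n : ℕ => d * n) atTop atTop :=
    tendsto_id.const_mul_atTop' (Nat.pos_of_ne_zero hd)
  refine tendsto_nhds_unique (h.comp hmul) ((hA.div_const (d : ℝ)).congr fun n => ?_)
  simp only [Function.comp, pdens_eq_count, count_image_mul A hd]
  push_cast
  rw [div_div, mul_comm]

theorem isComputablePerm_id : IsComputablePerm id := ⟨Function.bijective_id, Computable.id⟩

/-- The permutation sending the even numbers to the multiples of four, and the odd numbers
to the remaining numbers, both in increasing order. -/
def evenToFour (n : ℕ) : ℕ :=
  if n % 2 = 0 then 2 * n else n / 2 + n / 2 / 3 + 1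

theorem isComputablePerm_evenToFour : IsComputablePerm evenToFour := by
  refine ⟨⟨fun a b h => ?_, fun m => ?_⟩, Primrec.to_comp ?_⟩
  · unfold evenToFour at h
    split_ifs at h <;> lia
  · by_cases hm : m % 4 = 0
    · exact ⟨m / 2, by rw [evenToFour, if_pos (by lia)]; lia⟩
    · exact ⟨2 * (m - 1 - m / 4) + 1, by rw [evenToFour, if_neg (by lia)]; lia⟩
  · have hhalf : Primrec fun n : ℕ => n / 2 := Primrec.nat_div.comp Primrec.id (Primrec.const 2)
    exact Primrec.ite
      (Primrec.eq.comp (Primrec.nat_mod.comp Primrec.id (Primrec.const 2)) (Primrec.const 0))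
      (Primrec.nat_mul.comp (Primrec.const 2) Primrec.id)
      (Primrec.succ.comp
        (Primrec.nat_add.comp hhalf (Primrec.nat_div.comp hhalf (Primrec.const 3))))

theorem image_evenToFour_join_empty (A : Set ℕ) : evenToFour '' join A ∅ = (4 * ·) '' A := by
  rw [join_empty, image_image]
  refine image_congr fun n _ => ?_
  rw [evenToFour, if_pos (by lia)]
  lia

theorem not_hasIntrinsicDensity_join_empty {A : Set ℕ} {r s : ℝ} (hA : HasDensity A r)
    (hr : r ≠ 0) : ¬ HasIntrinsicDensity (join A ∅) s := by
  intro h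
  have h2 := h id isComputablePerm_id
  have h4 := h evenToFour isComputablePerm_evenToFour
  rw [image_id, join_empty] at h2
  rw [image_evenToFour_join_empty] at h4
  have e2 := hA.eq_div_of_image_mul two_ne_zero h2
  have e4 := hA.eq_div_of_image_mul four_ne_zero h4
  push_cast at e2 e4
  exact hr (by linarith)

theorem stmt15 (A : Set ℕ) (hA : HasIntrinsicDensity A (1 / 2)) :
    HasIntrinsicDensity (join A Aᶜ) (1 / 2) ∧
    into A (join A Aᶜ) = join A ∅ ∧
    ¬ ∃ r : ℝ, HasIntrinsicDensity (into A (join A Aᶜ)) r := by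
  have hdens : HasDensity A (1 / 2) := by simpa using hA id isComputablePerm_id
  have hcompl : HasIntrinsicDensity Aᶜ (1 / 2) := by
    have := hA.compl
    norm_num at this ⊢
    exact this
  refine ⟨hA.join hcompl, into_join_compl A, ?_⟩
  rintro ⟨r, hr⟩
  rw [into_join_compl] at hr
  exact not_hasIntrinsicDensity_join_empty hdens (by norm_num) hr
end

section
/- Let {S_i}_{i∈ℕ} be a sequence of pairwise disjoint subsets of ℕ such that each S_i has intrinsic density r_i, and suppose that lim_{n→∞} P̄(⋃_{i>n} S_i) = 0, where P̄ denotes absolute upper density. Then ⋃_{i∈ℕ} S_i has intrinsic density equal to the sum of the series Σ_{i=0}^∞ r_i. -/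
open Filter Set Topology

open scoped Classical

/-- The absolute upper density of `A`. -/
noncomputable def absUpperDensity (A : Set ℕ) : ℝ :=
  sSup {x : ℝ | ∃ π : ℕ → ℕ, IsComputablePerm π ∧ x = upperDensity (π '' A)}

/-- The absolute lower density of `A`. -/
noncomputable def absLowerDensity (A : Set ℕ) : ℝ :=
  sInf {x : ℝ | ∃ π : ℕ → ℕ, IsComputablePerm π ∧ x = lowerDensity (π '' A)}

theorem pdens_iUnion_eq_sum_add_tail {V : ℕ → Set ℕ}
    (hV : Pairwise (Function.onFun Disjoint V)) (m k : ℕ) :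
    pdens (⋃ i, V i) m =
      ∑ i ∈ Finset.range k, pdens (V i) m + pdens (⋃ i ∈ Set.Ici k, V i) m := by
  induction k with
  | zero => simp
  | succ k ih =>
    have hsplit : (⋃ i ∈ Set.Ici k, V i) = V k ∪ ⋃ i ∈ Set.Ici (k + 1), V i := by
      rw [← Set.biUnion_insert]
      congr 1
      ext i
      have : (k ≤ i) = (i = k ∨ k + 1 ≤ i) := by grind
      simp [this]
    have hd : Disjoint (V k) (⋃ i ∈ Set.Ici (k + 1), V i) := by
      refine Set.disjoint_iUnion₂_right.2 fun i hi => hV ?_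
      have : k + 1 ≤ i := hi
      omega
    rw [ih, hsplit, pdens_union hd, Finset.sum_range_succ]
    ring

theorem isBoundedUnder_pdens (A : Set ℕ) :
    IsBoundedUnder (· ≤ ·) atTop (pdens A) :=
  isBoundedUnder_of ⟨1, pdens_le_one A⟩

theorem upperDensity_le_one (A : Set ℕ) : upperDensity A ≤ 1 :=
  limsup_le_of_le (isBoundedUnder_of ⟨0, pdens_nonneg A⟩ :
      IsBoundedUnder (· ≥ ·) atTop (pdens A)).isCoboundedUnder_le
    (Eventually.of_forall (pdens_le_one A))

theorem upperDensity_image_le_absUpperDensity (A : Set ℕ) {π : ℕ → ℕ}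
    (hπ : IsComputablePerm π) : upperDensity (π '' A) ≤ absUpperDensity A := by
  refine le_csSup ⟨1, ?_⟩ ⟨π, hπ, rfl⟩
  rintro _ ⟨σ, -, rfl⟩
  exact upperDensity_le_one _

/-- A countable disjoint union of sets with densities has density the sum of the densities, as
soon as the upper densities of its tails are bounded by a null sequence. -/
theorem hasDensity_iUnion {V : ℕ → Set ℕ} {r a : ℕ → ℝ}
    (hV : Pairwise (Function.onFun Disjoint V)) (hr : ∀ i, HasDensity (V i) (r i))
    (ha : Tendsto a atTop (𝓝 0)) (hVa : ∀ n, upperDensity (⋃ i ∈ Set.Ioi n, V i) ≤ a n) :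
    HasDensity (⋃ i, V i) (∑' i, r i) := by
  have hr0 : ∀ i, 0 ≤ r i := fun i => ge_of_tendsto' (hr i) (pdens_nonneg _)
  have hsum : ∀ k, Tendsto (fun m => ∑ i ∈ Finset.range k, pdens (V i) m) atTop
      (𝓝 (∑ i ∈ Finset.range k, r i)) := fun k => tendsto_finsetSum _ fun i _ => hr i
  have hsummable : Summable r := by
    refine summable_of_sum_range_le (c := 1) hr0 fun k => le_of_tendsto' (hsum k) fun m => ?_
    have h := pdens_iUnion_eq_sum_add_tail hV m k
    linarith [pdens_le_one (⋃ i, V i) m, pdens_nonneg (⋃ i ∈ Set.Ici k, V i) m]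
  have hpartial := hsummable.hasSum.tendsto_sum_nat.comp (tendsto_add_atTop_nat 1)
  refine Metric.tendsto_atTop'.2 fun ε hε => ?_
  obtain ⟨n, hn, han⟩ := ((hpartial.eventually
    (Metric.ball_mem_nhds _ (by positivity : 0 < ε / 4))).and
    (ha.eventually_lt_const (by positivity : 0 < ε / 4))).exists
  have htail : ∀ᶠ m in atTop, pdens (⋃ i ∈ Set.Ioi n, V i) m < ε / 4 :=
    eventually_lt_of_limsup_lt ((hVa n).trans_lt han) (isBoundedUnder_pdens _)
  obtain ⟨N, hN⟩ := eventually_atTop.1 (((hsum (n + 1)).eventually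
    (Metric.ball_mem_nhds _ (by positivity : 0 < ε / 4))).and htail)
  refine ⟨N, fun m hm => ?_⟩
  obtain ⟨h1, h2⟩ := hN m hm.le
  have h3 := pdens_iUnion_eq_sum_add_tail hV m (n + 1)
  have hI : Set.Ici (n + 1) = Set.Ioi n := Set.ext fun _ => Nat.succ_le_iff
  rw [hI] at h3
  have h4 := pdens_nonneg (⋃ i ∈ Set.Ioi n, V i) m
  simp only [Function.comp_apply, Real.dist_eq, abs_lt] at hn h1 ⊢
  constructor <;> linarith [hn.1, hn.2, h1.1, h1.2]

theorem stmt16 (S : ℕ → Set ℕ) (r : ℕ → ℝ)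
    (hdisj : Pairwise (Function.onFun Disjoint S))
    (hdens : ∀ i, HasIntrinsicDensity (S i) (r i))
    (hlim : Filter.Tendsto (fun n => absUpperDensity (⋃ i ∈ Set.Ioi n, S i))
      Filter.atTop (nhds 0)) :
    HasIntrinsicDensity (⋃ i, S i) (∑' i, r i) := by
  intro π hπ
  rw [Set.image_iUnion]
  refine hasDensity_iUnion (fun i j hij => Set.disjoint_image_of_injective hπ.1.1 (hdisj hij))
    (fun i => hdens i π hπ) hlim fun n => ?_
  rw [← Set.image_iUnion₂]
  exact upperDensity_image_le_absUpperDensity _ hπ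
end
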